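/- On ℝ^5, the pair (P_0, P_1) defines a second bi-Hamiltonian structure adapted to the Toda first integrals: (i) the brackets {·,·}_{P_0} and {·,·}_{P_1} each satisfy the Jacobi identity for all smooth f, g, h : ℝ^5 → ℝ; (ii) they are compatible, i.e. for every λ ∈ ℝ the bracket {·,·}_{P_1} − λ{·,·}_{P_0} satisfies the Jacobi identity; (iii) f_0 = b_1 + b_2 + b_3 is a Casimir of {·,·}_{P_0} and f_2 = b_1b_2b_3 − b_1a_2² − b_3a_1² is a Casimir of {·,·}_{P_1}; and (iv) the Lenard–Magri relations hold: for every p ∈ ℝ^5 and i = 1,…,5, Σ_j (P_0)_{ij}(p)·(∂f_1/∂u_j)(p) = Σ_j (P_1)_{ij}(p)·(∂f_0/∂u_j)(p) and Σ_j (P_0)_{ij}(p)·(∂f_2/∂u_j)(p) = Σ_j (P_1)_{ij}(p)·(∂f_1/∂u_j)(p), where f_1 = a_1² + a_2² − b_1b_2 − b_1b_3 − b_2b_3. -/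

import Mathlib

open Matrix

/-- The bracket `{f,g}_Π(p) = Σ_{i,j} Π(p)_{ij} ∂f/∂u_i(p) ∂g/∂u_j(p)` on `ℝ^n` associated
to a matrix-valued function `P`. -/
noncomputable def mbracket {n : ℕ} (P : (Fin n → ℝ) → Matrix (Fin n) (Fin n) ℝ)
    (f g : (Fin n → ℝ) → ℝ) (p : Fin n → ℝ) : ℝ :=
  ∑ i, ∑ j, P p i j * fderiv ℝ f p (Pi.single i 1) * fderiv ℝ g p (Pi.single j 1)

/-- The `i`-th component of the Hamiltonian vector field of `h` with respect to `P`. -/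
noncomputable def hamVF {n : ℕ} (P : (Fin n → ℝ) → Matrix (Fin n) (Fin n) ℝ)
    (h : (Fin n → ℝ) → ℝ) (p : Fin n → ℝ) (i : Fin n) : ℝ :=
  ∑ j, P p i j * fderiv ℝ h p (Pi.single j 1)

/-- The linear Toda Poisson tensor `Π_0` on `ℝ^5`, in Flaschka coordinates
`(a_1,a_2,b_1,b_2,b_3) = (p 0, …, p 4)`. -/
noncomputable def TPi0 (p : Fin 5 → ℝ) : Matrix (Fin 5) (Fin 5) ℝ :=
  !![0,     0,    -p 0,  p 0,   0;
     0,     0,    0,     -p 1,  p 1;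
     p 0,   0,    0,     0,     0;
     -p 0,  p 1,  0,     0,     0;
     0,     -p 1, 0,     0,     0]

/-- The quadratic (Adler) Toda Poisson tensor `Π_1` on `ℝ^5`. -/
noncomputable def TPi1 (p : Fin 5 → ℝ) : Matrix (Fin 5) (Fin 5) ℝ :=
  !![0,              p 0 * p 1 / 2,  -p 0 * p 2,   p 0 * p 3,    0;
     -p 0 * p 1 / 2, 0,              0,            -p 1 * p 3,   p 1 * p 4;
     p 0 * p 2,      0,              0,            2 * p 0 ^ 2,  0;
     -p 0 * p 3,     p 1 * p 3,      -2 * p 0 ^ 2, 0,            2 * p 1 ^ 2;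
     0,              -p 1 * p 4,     0,            -2 * p 1 ^ 2, 0]

/-- The first tensor `P_0` of the second Toda bi-Hamiltonian structure on `ℝ^5`. -/
noncomputable def TP0 (p : Fin 5 → ℝ) : Matrix (Fin 5) (Fin 5) ℝ :=
  !![0,              -p 0 * p 1,    2 * p 0 * p 2,  -2 * p 0 * p 2, 0;
     p 0 * p 1,      0,             0,              2 * p 1 * p 4,  -2 * p 1 * p 4;
     -2 * p 0 * p 2, 0,             0,              0,              0;
     2 * p 0 * p 2,  -2 * p 1 * p 4, 0,             0,              0;
     0,              2 * p 1 * p 4, 0,              0,              0]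

/-- The second tensor `P_1` of the second Toda bi-Hamiltonian structure on `ℝ^5`. -/
noncomputable def TP1 (p : Fin 5 → ℝ) : Matrix (Fin 5) (Fin 5) ℝ :=
  !![0,                          -p 0 * p 1 * (p 2 + p 4),    2 * p 0 * p 2 ^ 2,  -2 * p 0 * (p 1 ^ 2 + p 2 * p 3), 0;
     p 0 * p 1 * (p 2 + p 4),    0,                           0,                  2 * p 1 * (p 0 ^ 2 + p 3 * p 4),  -2 * p 1 * p 4 ^ 2;
     -2 * p 0 * p 2 ^ 2,         0,                           0,                  -4 * p 0 ^ 2 * p 2,               0;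
     2 * p 0 * (p 1 ^ 2 + p 2 * p 3), -2 * p 1 * (p 0 ^ 2 + p 3 * p 4), 4 * p 0 ^ 2 * p 2, 0,                       -4 * p 1 ^ 2 * p 4;
     0,                          2 * p 1 * p 4 ^ 2,           0,                  4 * p 1 ^ 2 * p 4,                0]

section Jacobi

variable {n : ℕ}

/-- The vector with components `Σ_i P_{ij}(p) ∂_i f(p)`, that is, the derivation `{f, ·}_P` at
`p`. -/
noncomputable def bracketVector (P : (Fin n → ℝ) → Matrix (Fin n) (Fin n) ℝ)
    (f : (Fin n → ℝ) → ℝ) (p : Fin n → ℝ) : Fin n → ℝ :=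
  (fun i => fderiv ℝ f p (Pi.single i 1)) ᵥ* P p

lemma clm_apply_eq_sum (L : (Fin n → ℝ) →L[ℝ] ℝ) (v : Fin n → ℝ) :
    L v = ∑ i, v i * L (Pi.single i 1) := by
  conv_lhs => rw [pi_eq_sum_univ' v]
  simp

lemma mbracket_eq_fderiv_bracketVector (P : (Fin n → ℝ) → Matrix (Fin n) (Fin n) ℝ)
    (f g : (Fin n → ℝ) → ℝ) (p : Fin n → ℝ) :
    mbracket P f g p = fderiv ℝ g p (bracketVector P f p) := by
  rw [clm_apply_eq_sum, mbracket, Finset.sum_comm]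
  refine Finset.sum_congr rfl fun j _ => ?_
  rw [bracketVector, vecMul, dotProduct, Finset.sum_mul]
  exact Finset.sum_congr rfl fun i _ => by ring

lemma bracketVector_of_skew {P : (Fin n → ℝ) → Matrix (Fin n) (Fin n) ℝ}
    (hP : ∀ p i j, P p i j = -P p j i) (f : (Fin n → ℝ) → ℝ) (p : Fin n → ℝ) (i : Fin n) :
    ∑ j, P p i j * fderiv ℝ f p (Pi.single j 1) = -bracketVector P f p i := by
  rw [bracketVector, vecMul, dotProduct, ← Finset.sum_neg_distrib]
  exact Finset.sum_congr rfl fun j _ => by rw [hP p i j]; ring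

/-- Leibniz rule for the derivative of a bracket along `v`. -/
lemma fderiv_mbracket {P : (Fin n → ℝ) → Matrix (Fin n) (Fin n) ℝ}
    (hP : ∀ p i j, P p i j = -P p j i) (hd : ∀ i j, Differentiable ℝ fun q => P q i j)
    {g h : (Fin n → ℝ) → ℝ} (hg : ContDiff ℝ 2 g) (hh : ContDiff ℝ 2 h) (p v : Fin n → ℝ) :
    fderiv ℝ (mbracket P g h) p v =
      ∑ i, ∑ j, fderiv ℝ (fun q => P q i j) p v * fderiv ℝ g p (Pi.single i 1) *
          fderiv ℝ h p (Pi.single j 1)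
        - fderiv ℝ (fderiv ℝ g) p v (bracketVector P h p)
        + fderiv ℝ (fderiv ℝ h) p v (bracketVector P g p) := by
  have hg' : Differentiable ℝ (fderiv ℝ g) :=
    (hg.fderiv_right (m := 1) (by norm_num)).differentiable (by norm_num)
  have hh' : Differentiable ℝ (fderiv ℝ h) :=
    (hh.fderiv_right (m := 1) (by norm_num)).differentiable (by norm_num)
  have hfd : ∀ {k : (Fin n → ℝ) → ℝ}, Differentiable ℝ (fderiv ℝ k) → ∀ i : Fin n,
      HasFDerivAt (fun q => fderiv ℝ k q (Pi.single i 1))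
        ((fderiv ℝ (fderiv ℝ k) p).flip (Pi.single i 1)) p := fun hk i => by
    simpa using (hk p).hasFDerivAt.clm_apply (hasFDerivAt_const (Pi.single i (1 : ℝ)) p)
  have key : HasFDerivAt (mbracket P g h) _ p :=
    HasFDerivAt.fun_sum fun i _ => HasFDerivAt.fun_sum fun j _ =>
      (((hd i j) p).hasFDerivAt.mul (hfd hg' i)).mul (hfd hh' j)
  rw [key.fderiv]
  have e1 : fderiv ℝ (fderiv ℝ g) p v (bracketVector P h p) =
      -∑ i, ∑ j, P p i j * fderiv ℝ (fderiv ℝ g) p v (Pi.single i 1) *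
        fderiv ℝ h p (Pi.single j 1) := by
    rw [clm_apply_eq_sum, ← Finset.sum_neg_distrib]
    refine Finset.sum_congr rfl fun i _ => ?_
    rw [← neg_neg (bracketVector P h p i), ← bracketVector_of_skew hP, neg_mul, Finset.sum_mul]
    exact congrArg _ (Finset.sum_congr rfl fun j _ => by ring)
  have e2 : fderiv ℝ (fderiv ℝ h) p v (bracketVector P g p) =
      ∑ i, ∑ j, P p i j * fderiv ℝ g p (Pi.single i 1) *
        fderiv ℝ (fderiv ℝ h) p v (Pi.single j 1) := by
    rw [clm_apply_eq_sum, Finset.sum_comm]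
    refine Finset.sum_congr rfl fun j _ => ?_
    rw [bracketVector, vecMul, dotProduct, Finset.sum_mul]
    exact Finset.sum_congr rfl fun i _ => by ring
  rw [e1, e2, sub_neg_eq_add, ← Finset.sum_add_distrib, ← Finset.sum_add_distrib]
  simp only [_root_.sum_apply]
  refine Finset.sum_congr rfl fun i _ => ?_
  rw [← Finset.sum_add_distrib, ← Finset.sum_add_distrib]
  refine Finset.sum_congr rfl fun j _ => ?_
  simp
  ring

/-- A skew-symmetric differentiable tensor whose Schouten square vanishes (tested on triples of
covectors) defines a bracket satisfying the Jacobi identity. -/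
lemma mbracket_jacobi {P : (Fin n → ℝ) → Matrix (Fin n) (Fin n) ℝ}
    (hP : ∀ p i j, P p i j = -P p j i) (hd : ∀ i j, Differentiable ℝ fun q => P q i j)
    (hS : ∀ (p x y z : Fin n → ℝ),
      ∑ i, ∑ j, fderiv ℝ (fun q => P q i j) p (x ᵥ* P p) * y i * z j
        + ∑ i, ∑ j, fderiv ℝ (fun q => P q i j) p (y ᵥ* P p) * z i * x j
        + ∑ i, ∑ j, fderiv ℝ (fun q => P q i j) p (z ᵥ* P p) * x i * y j = 0)
    {f g h : (Fin n → ℝ) → ℝ} (hf : ContDiff ℝ 2 f) (hg : ContDiff ℝ 2 g) (hh : ContDiff ℝ 2 h)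
    (p : Fin n → ℝ) :
    mbracket P f (mbracket P g h) p + mbracket P g (mbracket P h f) p
      + mbracket P h (mbracket P f g) p = 0 := by
  have symm : ∀ {k : (Fin n → ℝ) → ℝ}, ContDiff ℝ 2 k → ∀ v w,
      fderiv ℝ (fderiv ℝ k) p v w = fderiv ℝ (fderiv ℝ k) p w v := fun hk v w =>
    (hk.contDiffAt.isSymmSndFDerivAt (by simp)).eq v w
  rw [mbracket_eq_fderiv_bracketVector P f, mbracket_eq_fderiv_bracketVector P g,
    mbracket_eq_fderiv_bracketVector P h, fderiv_mbracket hP hd hg hh,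
    fderiv_mbracket hP hd hh hf, fderiv_mbracket hP hd hf hg,
    symm hf (bracketVector P g p), symm hg (bracketVector P f p), symm hh (bracketVector P f p)]
  have := hS p (fun i => fderiv ℝ f p (Pi.single i 1)) (fun i => fderiv ℝ g p (Pi.single i 1))
    (fun i => fderiv ℝ h p (Pi.single i 1))
  simp only [bracketVector] at this ⊢
  linarith

lemma mbracket_linear_combination (P Q : (Fin n → ℝ) → Matrix (Fin n) (Fin n) ℝ) (s t : ℝ)
    (f g : (Fin n → ℝ) → ℝ) (p : Fin n → ℝ) :
    mbracket (fun q => s • P q + t • Q q) f g p = s * mbracket P f g p + t * mbracket Q f g p := by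
  simp only [mbracket, Finset.mul_sum, ← Finset.sum_add_distrib, Matrix.add_apply,
    Matrix.smul_apply, smul_eq_mul]
  exact Finset.sum_congr rfl fun i _ => Finset.sum_congr rfl fun j _ => by ring

end Jacobi

/-- The directional derivative of `TP0` at `p` along `v`. -/
def dTP0 (p v : Fin 5 → ℝ) : Matrix (Fin 5) (Fin 5) ℝ :=
  let α := v 0 * p 1 + p 0 * v 1
  let β := 2 * (v 0 * p 2 + p 0 * v 2)
  let γ := 2 * (v 1 * p 4 + p 1 * v 4)
  !![0, -α, β, -β, 0;
     α, 0, 0, γ, -γ;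
     -β, 0, 0, 0, 0;
     β, -γ, 0, 0, 0;
     0, γ, 0, 0, 0]

/-- The directional derivative of `TP1` at `p` along `v`. -/
def dTP1 (p v : Fin 5 → ℝ) : Matrix (Fin 5) (Fin 5) ℝ :=
  let α := (v 0 * p 1 + p 0 * v 1) * (p 2 + p 4) + p 0 * p 1 * (v 2 + v 4)
  let β := 2 * v 0 * p 2 ^ 2 + 4 * p 0 * p 2 * v 2
  let γ := 2 * v 0 * (p 1 ^ 2 + p 2 * p 3) + 2 * p 0 * (2 * p 1 * v 1 + v 2 * p 3 + p 2 * v 3)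
  let δ := 2 * v 1 * (p 0 ^ 2 + p 3 * p 4) + 2 * p 1 * (2 * p 0 * v 0 + v 3 * p 4 + p 3 * v 4)
  let ε := 2 * v 1 * p 4 ^ 2 + 4 * p 1 * p 4 * v 4
  let ζ := 8 * p 0 * v 0 * p 2 + 4 * p 0 ^ 2 * v 2
  let η := 8 * p 1 * v 1 * p 4 + 4 * p 1 ^ 2 * v 4
  !![0, -α, β, -γ, 0;
     α, 0, 0, δ, -ε;
     -β, 0, 0, -ζ, 0;
     γ, -δ, ζ, 0, -η;
     0, ε, 0, η, 0]

lemma differentiable_TP0 (i j : Fin 5) : Differentiable ℝ fun q => TP0 q i j := by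
  fin_cases i <;> fin_cases j <;> simp [TP0] <;> fun_prop

lemma differentiable_TP1 (i j : Fin 5) : Differentiable ℝ fun q => TP1 q i j := by
  fin_cases i <;> fin_cases j <;> simp [TP1] <;> fun_prop

lemma fderiv_coord (p v : Fin 5 → ℝ) (i : Fin 5) :
    fderiv ℝ (fun q : Fin 5 → ℝ => q i) p v = v i := by
  rw [(hasFDerivAt_apply i p).fderiv]; rfl

lemma fderiv_TP0 (p v : Fin 5 → ℝ) (i j : Fin 5) :
    fderiv ℝ (fun q => TP0 q i j) p v = dTP0 p v i j := by
  fin_cases i <;> fin_cases j <;> simp [TP0, dTP0] <;>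
    (simp (disch := fun_prop) [fderiv_fun_mul, fderiv_coord]; ring)

lemma fderiv_TP1 (p v : Fin 5 → ℝ) (i j : Fin 5) :
    fderiv ℝ (fun q => TP1 q i j) p v = dTP1 p v i j := by
  fin_cases i <;> fin_cases j <;> simp [TP1, dTP1] <;>
    (simp (disch := fun_prop) [fderiv_fun_mul, fderiv_fun_pow, fderiv_fun_add, fderiv_coord]; ring)

lemma toda_pencil_jacobi (s t : ℝ) {f g h : (Fin 5 → ℝ) → ℝ} (hf : ContDiff ℝ 2 f)
    (hg : ContDiff ℝ 2 g) (hh : ContDiff ℝ 2 h) (p : Fin 5 → ℝ) :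
    let P : (Fin 5 → ℝ) → Matrix (Fin 5) (Fin 5) ℝ := fun q => s • TP1 q + t • TP0 q
    mbracket P f (mbracket P g h) p + mbracket P g (mbracket P h f) p
      + mbracket P h (mbracket P f g) p = 0 := by
  refine mbracket_jacobi ?_ (fun i j => ?_) ?_ hf hg hh p
  · intro p i j
    fin_cases i <;> fin_cases j <;> simp [TP0, TP1] <;> ring
  · exact ((differentiable_TP1 i j).const_mul s).add ((differentiable_TP0 i j).const_mul t)
  · intro p x y z
    have hd : ∀ i j v, fderiv ℝ (fun q => (s • TP1 q + t • TP0 q) i j) p v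
        = s * dTP1 p v i j + t * dTP0 p v i j := by
      intro i j v
      have := (((differentiable_TP1 i j) p).hasFDerivAt.const_mul s).add
        (((differentiable_TP0 i j) p).hasFDerivAt.const_mul t)
      rw [← fderiv_TP1, ← fderiv_TP0]
      exact DFunLike.congr_fun this.fderiv v
    simp only [hd]
    simp [Fin.sum_univ_five, vecMul, dotProduct, TP0, TP1, dTP0, dTP1]
    ring

/-- The pair `(P_0, P_1)` defines a second bi-Hamiltonian structure on
`ℝ^5` adapted to the Toda first integrals: (i) both brackets satisfy the Jacobi identity;
(ii) they are compatible; (iii) `f_0` is a Casimir of `{·,·}_{P_0}` and `f_2` is a Casimir of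
`{·,·}_{P_1}`; (iv) the Lenard–Magri relations hold. -/
theorem second_Toda_biHamiltonian :
    -- (i) Jacobi identity for both brackets
    (∀ f g h : (Fin 5 → ℝ) → ℝ, ContDiff ℝ (⊤ : ℕ∞) f → ContDiff ℝ (⊤ : ℕ∞) g → ContDiff ℝ (⊤ : ℕ∞) h →
      ∀ p : Fin 5 → ℝ,
        mbracket TP0 f (mbracket TP0 g h) p + mbracket TP0 g (mbracket TP0 h f) p
          + mbracket TP0 h (mbracket TP0 f g) p = 0) ∧
    (∀ f g h : (Fin 5 → ℝ) → ℝ, ContDiff ℝ (⊤ : ℕ∞) f → ContDiff ℝ (⊤ : ℕ∞) g → ContDiff ℝ (⊤ : ℕ∞) h →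
      ∀ p : Fin 5 → ℝ,
        mbracket TP1 f (mbracket TP1 g h) p + mbracket TP1 g (mbracket TP1 h f) p
          + mbracket TP1 h (mbracket TP1 f g) p = 0) ∧
    -- (ii) compatibility: the pencil satisfies the Jacobi identity
    (∀ l : ℝ, ∀ f g h : (Fin 5 → ℝ) → ℝ,
      ContDiff ℝ (⊤ : ℕ∞) f → ContDiff ℝ (⊤ : ℕ∞) g → ContDiff ℝ (⊤ : ℕ∞) h →
      ∀ p : Fin 5 → ℝ,
        (mbracket TP1 f (fun q => mbracket TP1 g h q - l * mbracket TP0 g h q) p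
          - l * mbracket TP0 f (fun q => mbracket TP1 g h q - l * mbracket TP0 g h q) p)
        + (mbracket TP1 g (fun q => mbracket TP1 h f q - l * mbracket TP0 h f q) p
          - l * mbracket TP0 g (fun q => mbracket TP1 h f q - l * mbracket TP0 h f q) p)
        + (mbracket TP1 h (fun q => mbracket TP1 f g q - l * mbracket TP0 f g q) p
          - l * mbracket TP0 h (fun q => mbracket TP1 f g q - l * mbracket TP0 f g q) p)
          = 0) ∧
    -- (iii) Casimirs
    (∀ g : (Fin 5 → ℝ) → ℝ, ContDiff ℝ (⊤ : ℕ∞) g →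
      ∀ p : Fin 5 → ℝ, mbracket TP0 (fun q => q 2 + q 3 + q 4) g p = 0) ∧
    (∀ g : (Fin 5 → ℝ) → ℝ, ContDiff ℝ (⊤ : ℕ∞) g →
      ∀ p : Fin 5 → ℝ,
        mbracket TP1 (fun q => q 2 * q 3 * q 4 - q 2 * q 1 ^ 2 - q 4 * q 0 ^ 2) g p = 0) ∧
    -- (iv) Lenard–Magri relations
    (∀ (p : Fin 5 → ℝ) (i : Fin 5),
      hamVF TP0 (fun q => q 0 ^ 2 + q 1 ^ 2 - q 2 * q 3 - q 2 * q 4 - q 3 * q 4) p i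
        = hamVF TP1 (fun q => q 2 + q 3 + q 4) p i ∧
      hamVF TP0 (fun q => q 2 * q 3 * q 4 - q 2 * q 1 ^ 2 - q 4 * q 0 ^ 2) p i
        = hamVF TP1 (fun q => q 0 ^ 2 + q 1 ^ 2 - q 2 * q 3 - q 2 * q 4 - q 3 * q 4) p i) := by
  have two_le : (2 : WithTop ℕ∞) ≤ ((⊤ : ℕ∞) : WithTop ℕ∞) := WithTop.coe_le_coe.2 le_top
  refine ⟨fun f g h hf hg hh p => ?_, fun f g h hf hg hh p => ?_,
    fun l f g h hf hg hh p => ?_, fun g _ p => ?_, fun g _ p => ?_, fun p i => ?_⟩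
  · simpa using toda_pencil_jacobi 0 1 (hf.of_le two_le) (hg.of_le two_le)
      (hh.of_le two_le) p
  · simpa using toda_pencil_jacobi 1 0 (hf.of_le two_le) (hg.of_le two_le)
      (hh.of_le two_le) p
  · have e : ∀ u v : (Fin 5 → ℝ) → ℝ, (fun q => mbracket TP1 u v q - l * mbracket TP0 u v q)
        = mbracket (fun q => (1 : ℝ) • TP1 q + (-l) • TP0 q) u v := fun u v => by
      funext q
      rw [mbracket_linear_combination]
      ring
    rw [e g h, e h f, e f g]
    have e' := fun u v => congrFun (e u v) p
    rw [e', e', e']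
    exact toda_pencil_jacobi 1 (-l) (hf.of_le two_le) (hg.of_le two_le)
      (hh.of_le two_le) p
  · simp (disch := fun_prop) [mbracket, Fin.sum_univ_five, TP0, fderiv_fun_add, fderiv_coord,
      Pi.single_apply]
  · simp (disch := fun_prop) [mbracket, Fin.sum_univ_five, TP1, fderiv_fun_sub,
      fderiv_fun_mul, fderiv_fun_pow, fderiv_coord, Pi.single_apply]
    ring
  · constructor <;> fin_cases i <;>
    · simp (disch := fun_prop) [hamVF, Fin.sum_univ_five, TP0, TP1, fderiv_fun_add,
        fderiv_fun_sub, fderiv_fun_mul, fderiv_fun_pow, fderiv_coord, Pi.single_apply]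
      try ring
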